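/- In the α = 1 balls-and-bins model, the limit Θ = lim Θ_n of the proportion martingale is almost surely strictly positive (and by symmetry strictly less than 1); i.e., P(Θ ∈ {0,1}) = 0 for any positive sequence (σ_n). -/

import Mathlib

open MeasureTheory Filter

lemma bb_condExp {Ω : Type*} {m m0 : MeasurableSpace Ω} {μ : Measure Ω}
    [IsProbabilityMeasure μ] (B : Ω → ℕ) (hB : Measurable[m0] B) (s : ℕ)
    (hBle : ∀ ω, B ω ≤ s) (p : Ω → ℝ)
    (hbin : ∀ k ≤ s, μ[Set.indicator {ω | B ω = k} (fun _ => (1 : ℝ)) | m] =ᵐ[μ]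
        fun ω => (s.choose k : ℝ) * (p ω) ^ k * (1 - p ω) ^ (s - k)) (h : ℕ → ℝ) :
    μ[fun ω => h (B ω) | m] =ᵐ[μ] fun ω => ∑ k ∈ Finset.range (s + 1),
      h k * ((s.choose k : ℝ) * (p ω) ^ k * (1 - p ω) ^ (s - k)) := by
  have e : (fun ω => h (B ω)) = ∑ k ∈ Finset.range (s + 1),
      h k • Set.indicator {ω | B ω = k} (fun _ => (1 : ℝ)) := by
    funext ω
    rw [Finset.sum_apply, Finset.sum_eq_single (B ω)]
    · simp
    · intro b _ hb
      simp [Set.indicator, hb.symm]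
    · intro hb
      exact absurd (Finset.mem_range.2 (Nat.lt_succ_of_le (hBle ω))) hb
  have hint : ∀ k ∈ Finset.range (s + 1),
      Integrable (h k • Set.indicator {ω | B ω = k} (fun _ => (1 : ℝ))) μ := by
    intro k _
    exact ((integrable_const (1 : ℝ)).indicator (hB (measurableSet_singleton k))).smul (h k)
  rw [e]
  refine (condExp_finsetSum hint m).trans ?_
  have hall : ∀ᵐ ω ∂μ, ∀ k ∈ Finset.range (s + 1),
      (μ[h k • Set.indicator {ω | B ω = k} (fun _ => (1 : ℝ)) | m]) ω =
        h k * ((s.choose k : ℝ) * (p ω) ^ k * (1 - p ω) ^ (s - k)) := by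
    rw [Filter.eventually_all_finset]
    intro k hk
    filter_upwards [condExp_smul (μ := μ) (h k)
      (Set.indicator {ω | B ω = k} (fun _ => (1 : ℝ))) m,
      hbin k (Nat.lt_succ_iff.1 (Finset.mem_range.1 hk))] with ω h1 h2
    rw [h1, Pi.smul_apply, h2, smul_eq_mul]
  filter_upwards [hall] with ω hω
  rw [Finset.sum_apply]
  exact Finset.sum_congr rfl hω

lemma bb_mean (s : ℕ) (x : ℝ) :
    ∑ k ∈ Finset.range (s + 1), (k : ℝ) * ((s.choose k : ℝ) * x ^ k * (1 - x) ^ (s - k))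
      = s * x := by
  have h := congrArg (Polynomial.eval x) (bernsteinPolynomial.sum_smul ℝ s)
  simpa [bernsteinPolynomial, Polynomial.eval_finsetSum] using h

lemma bb_gen (s : ℕ) (x r : ℝ) :
    ∑ k ∈ Finset.range (s + 1), Real.exp (-(r * k)) *
      ((s.choose k : ℝ) * x ^ k * (1 - x) ^ (s - k))
      = (1 - x * (1 - Real.exp (-r))) ^ s := by
  have : 1 - x * (1 - Real.exp (-r)) = x * Real.exp (-r) + (1 - x) := by ring
  rw [this, add_pow]
  refine Finset.sum_congr rfl fun k _ => ?_
  rw [mul_pow, ← Real.exp_nat_mul, show (k : ℝ) * -r = -(r * k) by ring]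
  ring

lemma bb_step {Ω : Type*} {m m0 : MeasurableSpace Ω} {μ : Measure Ω}
    [IsProbabilityMeasure μ] (hm : m ≤ m0) (B : Ω → ℕ) (hB : Measurable[m0] B) (s : ℕ)
    (hBle : ∀ ω, B ω ≤ s) (p : Ω → ℝ) (hp : Measurable[m] p)
    (hp0 : ∀ ω, 0 ≤ p ω) (hp1 : ∀ ω, p ω ≤ 1)
    (hbin : ∀ k ≤ s, μ[Set.indicator {ω | B ω = k} (fun _ => (1 : ℝ)) | m] =ᵐ[μ]
        fun ω => (s.choose k : ℝ) * (p ω) ^ k * (1 - p ω) ^ (s - k))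
    (X : Ω → ℕ) (hX : Measurable[m] X) (r : ℝ) (hr : 0 ≤ r) :
    ∫ ω, Real.exp (-(r * ((X ω : ℝ) + B ω))) ∂μ ≤
      ∫ ω, Real.exp (-(r * X ω + s * p ω * (1 - Real.exp (-r)))) ∂μ := by
  set f : Ω → ℝ := fun ω => Real.exp (-(r * X ω)) with hf
  set g : Ω → ℝ := fun ω => Real.exp (-(r * B ω)) with hg
  have hXr : Measurable[m] (fun ω => (X ω : ℝ)) := measurable_from_top.comp hX
  have hfm : Measurable[m] f := Real.measurable_exp.comp ((hXr.const_mul r).neg)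
  have hgm : Measurable[m0] g := measurable_from_top.comp hB (g := fun k : ℕ => Real.exp (-(r * k)))
  have hf1 : ∀ ω, ‖f ω‖ ≤ 1 := fun ω => by
    rw [Real.norm_eq_abs, abs_of_pos (Real.exp_pos _)]
    exact Real.exp_le_one_iff.2 (neg_nonpos.2 (by positivity))
  have hg1 : ∀ ω, ‖g ω‖ ≤ 1 := fun ω => by
    rw [Real.norm_eq_abs, abs_of_pos (Real.exp_pos _)]
    exact Real.exp_le_one_iff.2 (neg_nonpos.2 (by positivity))
  have hgi : Integrable g μ := Integrable.of_bound hgm.aestronglyMeasurable 1 (ae_of_all _ hg1)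
  have hfm0 : Measurable[m0] f := hfm.mono hm le_rfl
  have hfgi : Integrable (f * g) μ := by
    refine Integrable.of_bound (hfm0.mul hgm).aestronglyMeasurable 1 (ae_of_all _ fun ω => ?_)
    rw [Pi.mul_apply, norm_mul]
    exact mul_le_one₀ (hf1 ω) (norm_nonneg _) (hg1 ω)
  have e1 : ∫ ω, Real.exp (-(r * ((X ω : ℝ) + B ω))) ∂μ = ∫ ω, (f * g) ω ∂μ := by
    refine integral_congr_ae (ae_of_all _ fun ω => ?_)
    simp only [hf, hg, Pi.mul_apply, ← Real.exp_add]
    congr 1; ring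
  rw [e1, ← integral_condExp hm]
  refine integral_mono_ae integrable_condExp ?_ ?_
  · have hpm0 := hp.mono hm le_rfl
    have hX0 := hXr.mono hm le_rfl
    refine Integrable.of_bound (Measurable.aestronglyMeasurable (by fun_prop)) 1
      (ae_of_all _ fun ω => ?_)
    rw [Real.norm_eq_abs, abs_of_pos (Real.exp_pos _)]
    refine Real.exp_le_one_iff.2 (neg_nonpos.2 ?_)
    have := hp0 ω
    have h2 : 0 ≤ 1 - Real.exp (-r) := sub_nonneg.2 (Real.exp_le_one_iff.2 (by linarith))
    positivity
  · filter_upwards [condExp_mul_of_stronglyMeasurable_left hfm.stronglyMeasurable hfgi hgi,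
      bb_condExp B hB s hBle p hbin (fun k => Real.exp (-(r * k)))] with ω h1 h2
    rw [h1, Pi.mul_apply, h2, bb_gen]
    have h2 : 0 ≤ 1 - Real.exp (-r) := sub_nonneg.2 (Real.exp_le_one_iff.2 (by linarith))
    have h3 : 1 - Real.exp (-r) ≤ 1 := by linarith [Real.exp_pos (-r)]
    have h4 : 0 ≤ 1 - p ω * (1 - Real.exp (-r)) := by nlinarith [hp0 ω, hp1 ω]
    calc f ω * (1 - p ω * (1 - Real.exp (-r))) ^ s
        ≤ f ω * (Real.exp (-(p ω * (1 - Real.exp (-r))))) ^ s := by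
          refine mul_le_mul_of_nonneg_left (pow_le_pow_left₀ h4 ?_ s) (Real.exp_pos _).le
          exact Real.one_sub_le_exp_neg _
      _ = _ := by
          rw [← Real.exp_nat_mul, hf, ← Real.exp_add]
          congr 1; ring

lemma bb_exp_bound (x : ℝ) (hx : 0 ≤ x) : x - x ^ 2 / 2 ≤ 1 - Real.exp (-x) := by
  have h1 := Real.quadratic_le_exp_of_nonneg hx
  have h2 : Real.exp (-x) * Real.exp x = 1 := by rw [← Real.exp_add]; simp
  have h3 := Real.exp_pos (-x)
  have h4 : Real.exp (-x) * (1 + x + x ^ 2 / 2) ≤ 1 := by nlinarith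
  have h5 : (1 - x + x ^ 2 / 2) * (1 + x + x ^ 2 / 2) ≥ 1 := by nlinarith [sq_nonneg (x ^ 2)]
  have h6 : 0 < 1 + x + x ^ 2 / 2 := by positivity
  nlinarith

/-- deterministic step inequality for the potential -/
lemma bb_det (M t s X : ℝ) (hM : 0 < M) (ht : M ≤ t) (hs : 0 < s) (hX : 0 ≤ X) :
    1 / (1 / M + 1 / t) * (X / t) ≤
      1 / (1 / M + 1 / (t + s)) / (t + s) * X + s * (X / t) *
        (1 - Real.exp (-(1 / (1 / M + 1 / (t + s)) / (t + s)))) := by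
  have ht0 : 0 < t := by linarith
  have e1 : 1 / (1 / M + 1 / t) = M * t / (M + t) := by field_simp; ring
  have e2 : 1 / (1 / M + 1 / (t + s)) / (t + s) = M / (M + t + s) := by field_simp; ring
  rw [e1, e2]
  set r := M / (M + t + s) with hr
  have hr0 : 0 ≤ r := by positivity
  have hb := bb_exp_bound r hr0
  have hk : M * t / (M + t) * (1 / t) ≤ r + s * (1 / t) * (r - r ^ 2 / 2) := by
    rw [hr, ← sub_nonneg]
    have : M / (M + t + s) + s * (1 / t) * (M / (M + t + s) - (M / (M + t + s)) ^ 2 / 2)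
        - M * t / (M + t) * (1 / t) =
        M * s * M * (M + t + 2 * s) / (2 * t * (M + t + s) ^ 2 * (M + t)) := by
      field_simp
      ring
    rw [this]
    positivity
  have h1 : s * (1 / t) * (r - r ^ 2 / 2) ≤ s * (1 / t) * (1 - Real.exp (-r)) :=
    mul_le_mul_of_nonneg_left hb (by positivity)
  have h2 := mul_le_mul_of_nonneg_right (hk.trans (add_le_add_right h1 r)) hX
  calc _ = M * t / (M + t) * (1 / t) * X := by ring
    _ ≤ _ := h2
    _ = _ := by ring

lemma bb_core {Ω : Type*} {m0 : MeasurableSpace Ω} {μ : Measure Ω}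
    [IsProbabilityMeasure μ] (ℱ : Filtration ℕ m0)
    (σn τn : ℕ → ℕ) (hσ : ∀ n, 1 ≤ σn n)
    (hτrec : ∀ n, τn (n + 1) = τn n + σn (n + 1))
    (T B : ℕ → Ω → ℕ)
    (hTpos : ∀ n ω, 1 ≤ T n ω) (hTle : ∀ n ω, T n ω ≤ τn n) (hτpos : ∀ n, 1 ≤ τn n)
    (hTrec : ∀ n ω, T (n + 1) ω = T n ω + B (n + 1) ω)
    (hTmeas : ∀ n, Measurable[ℱ n] (T n))
    (hBmeas : ∀ n, Measurable[m0] (B (n + 1)))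
    (hBle : ∀ n ω, B (n + 1) ω ≤ σn (n + 1))
    (hbinom : ∀ n, ∀ k ≤ σn (n + 1),
      μ[Set.indicator {ω | B (n + 1) ω = k} (fun _ => (1 : ℝ)) | ℱ n] =ᵐ[μ]
        fun ω => ((σn (n + 1)).choose k : ℝ) * ((T n ω : ℝ) / (τn n : ℝ)) ^ k *
          (1 - (T n ω : ℝ) / (τn n : ℝ)) ^ (σn (n + 1) - k)) :
    ∀ᵐ ω ∂μ, ¬ Tendsto (fun n => (T n ω : ℝ) / (τn n : ℝ)) atTop (nhds 0) := by
  have hτR : ∀ n, (0 : ℝ) < τn n := fun n => by exact_mod_cast hτpos n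
  have hτrecR : ∀ n, (τn (n + 1) : ℝ) = τn n + σn (n + 1) := fun n => by
    rw [hτrec]; push_cast; ring
  have hσR : ∀ n, (0 : ℝ) < σn n := fun n => by exact_mod_cast hσ n
  have hTm : ∀ n, Measurable[ℱ n] (fun ω => (T n ω : ℝ)) := fun n =>
    measurable_from_top.comp (hTmeas n)
  have hTm0 : ∀ n, Measurable[m0] (fun ω => (T n ω : ℝ)) := fun n => (hTm n).mono (ℱ.le n) le_rfl
  have hpm : ∀ n, Measurable[ℱ n] (fun ω => (T n ω : ℝ) / (τn n : ℝ)) := fun n =>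
    (hTm n).div_const _
  have hp0 : ∀ n ω, 0 ≤ (T n ω : ℝ) / (τn n : ℝ) := fun n ω => by positivity
  have hp1 : ∀ n ω, (T n ω : ℝ) / (τn n : ℝ) ≤ 1 := fun n ω => by
    rw [div_le_one (hτR n)]; exact_mod_cast hTle n ω
  have hstep : ∀ n (r : ℝ), 0 ≤ r → ∫ ω, Real.exp (-(r * (T (n + 1) ω : ℝ))) ∂μ ≤
      ∫ ω, Real.exp (-(r * T n ω + σn (n + 1) * ((T n ω : ℝ) / τn n) *
        (1 - Real.exp (-r)))) ∂μ := by
    intro n r hr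
    have := bb_step (μ := μ) (ℱ.le n) (B (n + 1)) (hBmeas n) (σn (n + 1)) (hBle n)
      (fun ω => (T n ω : ℝ) / (τn n : ℝ)) (hpm n) (hp0 n) (hp1 n) (hbinom n) (T n) (hTmeas n) r hr
    simpa only [hTrec, Nat.cast_add] using this
  have hexpint : ∀ (c : ℝ) n, 0 ≤ c → Integrable (fun ω => Real.exp (-(c * T n ω))) μ := by
    intro c n hc
    have := hTm0 n
    refine Integrable.of_bound (Measurable.aestronglyMeasurable (by fun_prop)) 1
      (ae_of_all _ fun ω => ?_)
    rw [Real.norm_eq_abs, abs_of_pos (Real.exp_pos _)]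
    exact Real.exp_le_one_iff.2 (neg_nonpos.2 (by positivity))
  -- comparison for one step
  have hcmp : ∀ n (r c d : ℝ), 0 ≤ r → 0 ≤ c → (∀ ω, c * T n ω + d ≤ r * T n ω +
      σn (n + 1) * ((T n ω : ℝ) / τn n) * (1 - Real.exp (-r))) →
      ∫ ω, Real.exp (-(r * (T (n + 1) ω : ℝ))) ∂μ ≤
        Real.exp (-d) * ∫ ω, Real.exp (-(c * T n ω)) ∂μ := by
    intro n r c d hr hc h
    refine (hstep n r hr).trans ?_
    rw [← integral_const_mul]
    refine integral_mono_of_nonneg (ae_of_all _ fun ω => (Real.exp_pos _).le)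
      ((hexpint c n hc).const_mul _) (ae_of_all _ fun ω => ?_)
    simp only
    rw [← Real.exp_add]
    exact Real.exp_le_exp.2 (by linarith [h ω])
  set a : ℕ → ℝ := fun n => ∫ ω, Real.exp (-(1 / 2 * (T n ω : ℝ))) ∂μ with ha
  set κ : ℝ := 1 - Real.exp (-(1 / 2)) with hκ
  have hκ0 : 0 < κ := sub_pos.2 (Real.exp_lt_one_iff.2 (by norm_num))
  have ha1 : ∀ n, a n ≤ Real.exp (-(κ * (Real.log (τn n) - Real.log (τn 0)))) := by
    intro n
    induction n with
    | zero =>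
      simp only [sub_self, mul_zero, neg_zero, Real.exp_zero]
      calc a 0 ≤ ∫ _, (1 : ℝ) ∂μ := by
            refine integral_mono (hexpint _ 0 (by norm_num)) (integrable_const _) fun ω => ?_
            exact Real.exp_le_one_iff.2 (neg_nonpos.2 (by positivity))
        _ = 1 := by simp
    | succ n ih =>
      have h1 := hcmp n (1 / 2) (1 / 2) (κ * (σn (n + 1) / τn n)) (by norm_num) (by norm_num) (by
        intro ω
        have : (1 : ℝ) ≤ T n ω := by exact_mod_cast hTpos n ω
        have h2 : 0 ≤ κ * (σn (n + 1) / τn n : ℝ) := by positivity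
        have h3 : (σn (n + 1) : ℝ) * ((T n ω : ℝ) / τn n) * (1 - Real.exp (-(1 / 2)))
          = κ * (σn (n + 1) / τn n : ℝ) * T n ω := by rw [hκ]; ring
        rw [h3]
        nlinarith)
      refine h1.trans ((mul_le_mul_of_nonneg_left ih (Real.exp_pos _).le).trans ?_)
      rw [← Real.exp_add]
      refine Real.exp_le_exp.2 ?_
      have h4 : Real.log (τn (n + 1)) - Real.log (τn n) ≤ σn (n + 1) / τn n := by
        rw [← Real.log_div (hτR _).ne' (hτR _).ne']
        refine (Real.log_le_sub_one_of_pos (div_pos (hτR _) (hτR _))).trans (le_of_eq ?_)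
        rw [hτrecR]
        have := (hτR n).ne'
        field_simp
        ring
      nlinarith [mul_le_mul_of_nonneg_left h4 hκ0.le]
  have hτtop : Tendsto (fun n => (τn n : ℝ)) atTop atTop := by
    refine tendsto_natCast_atTop_atTop.comp ?_
    refine (strictMono_nat_of_lt_succ fun n => ?_).tendsto_atTop
    rw [hτrec]; have := hσ (n + 1); omega
  have ha0 : Tendsto a atTop (nhds 0) := by
    refine squeeze_zero (fun n => integral_nonneg fun ω => (Real.exp_pos _).le) ha1 ?_
    refine Real.tendsto_exp_atBot.comp (tendsto_neg_atTop_atBot.comp ?_)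
    refine Tendsto.const_mul_atTop hκ0 ?_
    exact tendsto_atTop_add_const_right _ _ (Real.tendsto_log_atTop.comp hτtop)
  have hτmono : Monotone τn := monotone_nat_of_le_succ fun n => by rw [hτrec]; omega
  -- potential
  have hpot : ∀ m n, m ≤ n →
      ∫ ω, Real.exp (-(1 / (1 / (τn m : ℝ) + 1 / τn n) / τn n * (T n ω : ℝ))) ∂μ ≤ a m := by
    intro m n hmn
    have hM := hτR m
    induction n, hmn using Nat.le_induction with
    | base =>
      have : 1 / (1 / (τn m : ℝ) + 1 / τn m) / τn m = 1 / 2 := by field_simp; norm_num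
      rw [this]
    | succ n hmn ih =>
      have ht := hτR n
      have hs := hσR (n + 1)
      have ht' := hτR (n + 1)
      refine le_trans ?_ ih
      have := hcmp n (1 / (1 / (τn m : ℝ) + 1 / τn (n + 1)) / τn (n + 1))
        (1 / (1 / (τn m : ℝ) + 1 / τn n) / τn n) 0 (by positivity) (by positivity) (by
        intro ω
        have h := bb_det (τn m) (τn n) (σn (n + 1)) (T n ω) hM (by exact_mod_cast hτmono hmn)
          hs (by positivity)
        rw [hτrecR, add_zero]
        refine le_trans (le_of_eq ?_) h
        ring)
      simpa using this
  set A : Set Ω := {ω | Tendsto (fun n => (T n ω : ℝ) / (τn n : ℝ)) atTop (nhds 0)} with hA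
  have hAm : MeasurableSet A := measurableSet_tendsto _ (fun n => (hTm0 n).div_const _)
  have hbound : ∀ m, μ.real A ≤ a m := by
    intro m
    have hM := hτR m
    have hYm : ∀ n, Measurable (fun ω => Real.exp (-((τn m : ℝ) * ((T n ω : ℝ) / τn n)))) := by
      intro n
      have := hTm0 n
      fun_prop
    have hY1 : ∀ n ω, ‖Real.exp (-((τn m : ℝ) * ((T n ω : ℝ) / τn n)))‖ ≤ 1 := by
      intro n ω
      rw [Real.norm_eq_abs, abs_of_pos (Real.exp_pos _)]
      exact Real.exp_le_one_iff.2 (neg_nonpos.2 (by positivity))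
    have hlim : Tendsto (fun n => ∫ ω in A, Real.exp (-((τn m : ℝ) * ((T n ω : ℝ) / τn n))) ∂μ)
        atTop (nhds (∫ _ in A, (1 : ℝ) ∂μ)) := by
      refine tendsto_integral_of_dominated_convergence (fun _ => 1)
        (fun n => (hYm n).aestronglyMeasurable) (integrable_const _)
        (fun n => ae_of_all _ (hY1 n)) ?_
      rw [ae_restrict_iff' hAm]
      refine ae_of_all _ fun ω hω => ?_
      have h1 : Tendsto (fun n => -((τn m : ℝ) * ((T n ω : ℝ) / τn n))) atTop
          (nhds (-((τn m : ℝ) * 0))) := (Tendsto.const_mul _ hω).neg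
      have h2 := (Real.continuous_exp.tendsto _).comp h1
      simpa [Function.comp_def] using h2
    have he : ∫ _ in A, (1 : ℝ) ∂μ = μ.real A := by simp
    rw [he] at hlim
    refine le_of_tendsto hlim ?_
    filter_upwards [eventually_ge_atTop m] with n hn
    refine le_trans ?_ (hpot m n hn)
    have hYi : Integrable (fun ω => Real.exp (-((τn m : ℝ) * ((T n ω : ℝ) / τn n)))) μ :=
      Integrable.of_bound (hYm n).aestronglyMeasurable 1 (ae_of_all _ (hY1 n))
    refine (setIntegral_le_integral hYi (ae_of_all _ fun ω => (Real.exp_pos _).le)).trans ?_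
    have ht := hτR n
    refine integral_mono hYi (hexpint _ n (by positivity)) fun ω => ?_
    refine Real.exp_le_exp.2 (neg_le_neg ?_)
    have h1 : 1 / (1 / (τn m : ℝ) + 1 / τn n) ≤ τn m := by
      rw [div_le_iff₀ (by positivity), mul_add, mul_one_div_cancel hM.ne']
      have : 0 ≤ (τn m : ℝ) * (1 / τn n) := by positivity
      linarith
    calc _ = 1 / (1 / (τn m : ℝ) + 1 / τn n) * ((T n ω : ℝ) / τn n) := by ring
      _ ≤ _ := mul_le_mul_of_nonneg_right h1 (hp0 n ω)
  have hA0 : μ.real A = 0 :=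
    le_antisymm (ge_of_tendsto' ha0 hbound) measureReal_nonneg
  have hA1 : μ A = 0 := (measureReal_eq_zero_iff).1 hA0
  rw [ae_iff]
  simpa [hA] using hA1

lemma bb_conv {Ω : Type*} {m0 : MeasurableSpace Ω} {μ : Measure Ω}
    [IsProbabilityMeasure μ] (ℱ : Filtration ℕ m0)
    (σn τn : ℕ → ℕ)
    (hτrec : ∀ n, τn (n + 1) = τn n + σn (n + 1))
    (T B : ℕ → Ω → ℕ)
    (hTle : ∀ n ω, T n ω ≤ τn n) (hτpos : ∀ n, 1 ≤ τn n)
    (hTrec : ∀ n ω, T (n + 1) ω = T n ω + B (n + 1) ω)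
    (hTmeas : ∀ n, Measurable[ℱ n] (T n))
    (hBmeas : ∀ n, Measurable[m0] (B (n + 1)))
    (hBle : ∀ n ω, B (n + 1) ω ≤ σn (n + 1))
    (hbinom : ∀ n, ∀ k ≤ σn (n + 1),
      μ[Set.indicator {ω | B (n + 1) ω = k} (fun _ => (1 : ℝ)) | ℱ n] =ᵐ[μ]
        fun ω => ((σn (n + 1)).choose k : ℝ) * ((T n ω : ℝ) / (τn n : ℝ)) ^ k *
          (1 - (T n ω : ℝ) / (τn n : ℝ)) ^ (σn (n + 1) - k)) :
    ∀ᵐ ω ∂μ, ∃ l : ℝ, Tendsto (fun n => (T n ω : ℝ) / (τn n : ℝ)) atTop (nhds l) := by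
  have hτR : ∀ n, (0 : ℝ) < τn n := fun n => by exact_mod_cast hτpos n
  have hTm : ∀ n, Measurable[ℱ n] (fun ω => (T n ω : ℝ)) := fun n =>
    measurable_from_top.comp (hTmeas n)
  have hpm : ∀ n, Measurable[ℱ n] (fun ω => (T n ω : ℝ) / (τn n : ℝ)) := fun n =>
    (hTm n).div_const _
  have hp1 : ∀ n ω, ‖(T n ω : ℝ) / (τn n : ℝ)‖ ≤ 1 := fun n ω => by
    rw [Real.norm_eq_abs, abs_of_nonneg (by positivity), div_le_one (hτR n)]
    exact_mod_cast hTle n ω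
  have hint : ∀ n, Integrable (fun ω => (T n ω : ℝ) / (τn n : ℝ)) μ := fun n =>
    Integrable.of_bound ((hpm n).mono (ℱ.le n) le_rfl).aestronglyMeasurable 1
      (ae_of_all _ (hp1 n))
  have hmart : Martingale (fun n ω => (T n ω : ℝ) / (τn n : ℝ)) ℱ μ := by
    refine martingale_nat (fun n => (hpm n).stronglyMeasurable) hint fun n => ?_
    have hBi : Integrable (fun ω => (B (n + 1) ω : ℝ)) μ := by
      refine Integrable.of_bound (measurable_from_top.comp (hBmeas n)).aestronglyMeasurable
        (σn (n + 1)) (ae_of_all _ fun ω => ?_)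
      rw [Real.norm_eq_abs, abs_of_nonneg (by positivity)]
      exact_mod_cast hBle n ω
    set c : ℝ := (τn (n + 1) : ℝ)⁻¹ with hc
    set q : ℝ := (τn n : ℝ) / τn (n + 1) with hq
    have e : (fun ω => (T (n + 1) ω : ℝ) / (τn (n + 1) : ℝ)) =
        q • (fun ω => (T n ω : ℝ) / (τn n : ℝ)) + c • (fun ω => (B (n + 1) ω : ℝ)) := by
      funext ω
      have := (hτR n).ne'
      have := (hτR (n + 1)).ne'
      simp only [hTrec, Pi.add_apply, Pi.smul_apply, smul_eq_mul, hc, hq]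
      push_cast
      field_simp
    rw [e]
    filter_upwards [condExp_add ((hint n).smul q) (hBi.smul c) (ℱ n),
      condExp_smul (μ := μ) q (fun ω => (T n ω : ℝ) / (τn n : ℝ)) (ℱ n),
      condExp_smul (μ := μ) c (fun ω => (B (n + 1) ω : ℝ)) (ℱ n),
      bb_condExp (B (n + 1)) (hBmeas n) (σn (n + 1)) (hBle n) _ (hbinom n)
        (fun k => (k : ℝ))] with ω h1 h2 h3 h4
    rw [h1, Pi.add_apply, h2, h3, Pi.smul_apply, Pi.smul_apply, h4, bb_mean,
      condExp_of_stronglyMeasurable (ℱ.le n) (hpm n).stronglyMeasurable (hint n)]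
    simp only [smul_eq_mul, hc, hq]
    have := (hτR n).ne'
    have h5 := hτR (n + 1)
    have h6 : (τn (n + 1) : ℝ) = τn n + σn (n + 1) := by rw [hτrec]; push_cast; ring
    have h7 : (σn (n + 1) : ℝ) = τn (n + 1) - τn n := by linarith
    rw [h7]
    field_simp
    ring
  refine hmart.submartingale.exists_ae_tendsto_of_bdd (R := 1) fun n => ?_
  refine (eLpNorm_le_of_ae_bound (ae_of_all _ (hp1 n))).trans ?_
  simp

/-- in the α = 1 balls-and-bins model (B_{n+1} ~ Binomial(σ_{n+1}, Θ_n)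
given F_n), the a.s. limit Θ of the proportion martingale Θ_n = T_n/τ_n is almost
surely strictly between 0 and 1, i.e. P(Θ ∈ {0,1}) = 0, for any (σ_n). -/
theorem stmt16 {Ω : Type*} {m0 : MeasurableSpace Ω} {μ : Measure Ω}
    [IsProbabilityMeasure μ] (ℱ : Filtration ℕ m0)
    (σn τn : ℕ → ℕ) (hσ : ∀ n, 1 ≤ σn n)
    (hτrec : ∀ n, τn (n + 1) = τn n + σn (n + 1))
    (T B : ℕ → Ω → ℕ) (T0 : ℕ) (hT0pos : 0 < T0) (hT0lt : T0 < τn 0)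
    (hT0 : ∀ ω, T 0 ω = T0)
    (hTrec : ∀ n ω, T (n + 1) ω = T n ω + B (n + 1) ω)
    (hTmeas : ∀ n, StronglyMeasurable[ℱ n] (T n))
    (hBmeas : ∀ n, StronglyMeasurable[ℱ n] (B n))
    (hBle : ∀ n ω, B (n + 1) ω ≤ σn (n + 1))
    (hbinom : ∀ n, ∀ k ≤ σn (n + 1),
      μ[Set.indicator {ω | B (n + 1) ω = k} (fun _ => (1 : ℝ)) | ℱ n] =ᵐ[μ]
        fun ω => ((σn (n + 1)).choose k : ℝ) * ((T n ω : ℝ) / (τn n : ℝ)) ^ k *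
          (1 - (T n ω : ℝ) / (τn n : ℝ)) ^ (σn (n + 1) - k)) :
    ∀ᵐ ω ∂μ, ∃ l : ℝ, 0 < l ∧ l < 1 ∧
      Tendsto (fun n => (T n ω : ℝ) / (τn n : ℝ)) atTop (nhds l) := by
  have hτpos : ∀ n, 1 ≤ τn n := by
    intro n
    induction n with
    | zero => omega
    | succ n ih => rw [hτrec]; omega
  have hTpos : ∀ n ω, 1 ≤ T n ω := by
    intro n ω
    induction n with
    | zero => rw [hT0]; omega
    | succ n ih => rw [hTrec]; omega
  have hTlt : ∀ n ω, T n ω + 1 ≤ τn n := by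
    intro n ω
    induction n with
    | zero => rw [hT0]; omega
    | succ n ih => rw [hTrec, hτrec]; have := hBle n ω; omega
  have hTle : ∀ n ω, T n ω ≤ τn n := fun n ω => by have := hTlt n ω; omega
  have hTm : ∀ n, Measurable[ℱ n] (T n) := fun n => (hTmeas n).measurable
  have hBm : ∀ n, Measurable[m0] (B (n + 1)) := fun n =>
    (hBmeas (n + 1)).measurable.mono (ℱ.le _) le_rfl
  have hτR : ∀ n, (0 : ℝ) < τn n := fun n => by exact_mod_cast hτpos n
  have hc1 : ∀ n ω, ((τn n - T n ω : ℕ) : ℝ) / (τn n : ℝ) = 1 - (T n ω : ℝ) / (τn n : ℝ) := by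
    intro n ω
    rw [Nat.cast_sub (hTle n ω), sub_div, div_self (hτR n).ne']
  have hzero := bb_core ℱ σn τn hσ hτrec T B hTpos hTle hτpos hTrec hTm hBm hBle hbinom
  have hone := bb_core (μ := μ) ℱ σn τn hσ hτrec (fun n ω => τn n - T n ω)
    (fun n ω => σn n - B n ω) (fun n ω => by have := hTlt n ω; omega)
    (fun n ω => Nat.sub_le _ _) hτpos
    (fun n ω => by
      have := hTlt n ω
      have := hBle n ω
      simp only [hTrec, hτrec]; omega)
    (fun n => measurable_from_top.comp (hTm n) (g := fun k : ℕ => τn n - k))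
    (fun n => measurable_from_top.comp (hBm n) (g := fun k : ℕ => σn (n + 1) - k))
    (fun n ω => Nat.sub_le _ _)
    (by
      intro n k hk
      have hset : {ω | σn (n + 1) - B (n + 1) ω = k} = {ω | B (n + 1) ω = σn (n + 1) - k} := by
        ext ω
        have := hBle n ω
        simp only [Set.mem_ofPred_eq]
        omega
      rw [hset]
      filter_upwards [hbinom n (σn (n + 1) - k) (Nat.sub_le _ _)] with ω hω
      rw [hω, hc1, Nat.choose_symm hk, Nat.sub_sub_self hk, sub_sub_cancel]
      ring)
  filter_upwards [hzero, hone,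
    bb_conv ℱ σn τn hτrec T B hTle hτpos hTrec hTm hBm hBle hbinom] with ω h0 h1 ⟨l, hl⟩
  refine ⟨l, lt_of_le_of_ne ?_ ?_, lt_of_le_of_ne ?_ ?_, hl⟩
  · exact ge_of_tendsto' hl fun n => by positivity
  · rintro rfl
    exact h0 hl
  · refine le_of_tendsto' hl fun n => ?_
    rw [div_le_one (hτR n)]
    exact_mod_cast hTle n ω
  · rintro rfl
    apply h1
    simp only [hc1]
    simpa using hl.const_sub 1
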